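/- For any loss ℓ satisfying Assumption A and any γ ∈ (0,1], there exists a two-dimensional (d = 2) non-separable classification problem with objective L and minimizer w*, an integer k > 1, and an initialization w₀, such that the gradient descent iterates with constant step size η = γ/λ, where λ = λ_max(∇²L(w*)), started at w₀ converge to a cycle of period k > 1. -/

import Mathlib

open Filter Topology

/-- Assumption A on the individual loss function `ℓ`:
(i) `ℓ` is nonnegative, three-times continuously differentiable, strictly convex,
and tends to `0` at `-∞`;
(ii) `ℓ'` tends to `0` at `-∞` and to `1` at `+∞`;
(iii) `ℓ''` is increasing on `(-∞, 0]`, decreasing on `[0, ∞)`, and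
`(1/ε²)·ℓ''(1/ε) → 0` as `ε → 0`. -/
structure AssumptionA (ℓ : ℝ → ℝ) : Prop where
  nonneg : ∀ z, 0 ≤ ℓ z
  smooth : ContDiff ℝ 3 ℓ
  strictConvex : StrictConvexOn ℝ Set.univ ℓ
  tendsto_zero_atBot : Tendsto ℓ atBot (𝓝 0)
  deriv_tendsto_zero_atBot : Tendsto (deriv ℓ) atBot (𝓝 0)
  deriv_tendsto_one_atTop : Tendsto (deriv ℓ) atTop (𝓝 1)
  secondDeriv_strictMono : StrictMonoOn (deriv (deriv ℓ)) (Set.Iic 0)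
  secondDeriv_strictAnti : StrictAntiOn (deriv (deriv ℓ)) (Set.Ici 0)
  secondDeriv_decay :
    Tendsto (fun ε : ℝ => (1 / ε ^ 2) * deriv (deriv ℓ) (1 / ε)) (𝓝[≠] (0 : ℝ)) (𝓝 0)

namespace AssumptionA

variable {ℓ : ℝ → ℝ}

lemma contDiff_deriv (hA : AssumptionA ℓ) : ContDiff ℝ 2 (deriv ℓ) := by
  have h : ContDiff ℝ (2 + 1) ℓ := by
    have := hA.smooth
    norm_num
    exact this
  exact (contDiff_succ_iff_deriv.1 h).2.2

lemma differentiable (hA : AssumptionA ℓ) : Differentiable ℝ ℓ :=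
  hA.smooth.differentiable (by norm_num)

lemma differentiable_deriv (hA : AssumptionA ℓ) : Differentiable ℝ (deriv ℓ) :=
  hA.contDiff_deriv.differentiable (by norm_num)

lemma continuous_deriv (hA : AssumptionA ℓ) : Continuous (deriv ℓ) :=
  hA.contDiff_deriv.continuous

lemma continuous_secondDeriv (hA : AssumptionA ℓ) : Continuous (deriv (deriv ℓ)) :=
  hA.contDiff_deriv.continuous_deriv (by norm_num)

lemma secondDeriv_pos (hA : AssumptionA ℓ) (z : ℝ) : 0 < deriv (deriv ℓ) z := by
  have hmono : Monotone (deriv ℓ) := by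
    have h := hA.strictConvex.convexOn.monotoneOn_deriv
      (fun z _ => hA.differentiable z)
    exact monotoneOn_univ.1 h
  have hnn : ∀ z, 0 ≤ deriv (deriv ℓ) z := fun z => hmono.deriv_nonneg
  rcases le_total z 0 with hz | hz
  · exact (hnn (z - 1)).trans_lt
      (hA.secondDeriv_strictMono (Set.mem_Iic.2 (by linarith)) hz (by linarith))
  · exact (hnn (z + 1)).trans_lt
      (hA.secondDeriv_strictAnti hz (Set.mem_Ici.2 (by linarith)) (by linarith))

lemma deriv_strictMono (hA : AssumptionA ℓ) : StrictMono (deriv ℓ) :=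
  strictMono_of_deriv_pos hA.secondDeriv_pos

lemma deriv_pos (hA : AssumptionA ℓ) (z : ℝ) : 0 < deriv ℓ z :=
  (hA.deriv_strictMono.monotone.le_of_tendsto hA.deriv_tendsto_zero_atBot (z - 1)).trans_lt
    (hA.deriv_strictMono (by linarith))

lemma deriv_le_one (hA : AssumptionA ℓ) (z : ℝ) : deriv ℓ z ≤ 1 :=
  hA.deriv_strictMono.monotone.ge_of_tendsto hA.deriv_tendsto_one_atTop z

lemma tangent_le (hA : AssumptionA ℓ) (a z : ℝ) : ℓ a + deriv ℓ a * (z - a) ≤ ℓ z := by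
  have hc := hA.strictConvex.convexOn
  rcases lt_trichotomy a z with h | h | h
  · have := hc.deriv_le_slope (Set.mem_univ a) (Set.mem_univ z) h (hA.differentiable a)
    rw [slope_def_field, le_div_iff₀ (by linarith)] at this
    linarith
  · simp [h]
  · have := hc.slope_le_deriv (Set.mem_univ z) (Set.mem_univ a) h (hA.differentiable a)
    rw [slope_def_field, div_le_iff₀ (by linarith)] at this
    linarith

lemma tendsto_mul_secondDeriv (hA : AssumptionA ℓ) :
    Tendsto (fun z => z * deriv (deriv ℓ) z) atTop (𝓝 0) := by
  have h0 : Tendsto (fun z : ℝ => z⁻¹) atTop (𝓝[≠] 0) :=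
    tendsto_inv_atTop_nhdsGT_zero.mono_right
      (nhdsWithin_mono _ fun _ hx => ne_of_gt hx)
  have h1 := (hA.secondDeriv_decay.comp h0).mul tendsto_inv_atTop_zero
  rw [mul_zero] at h1
  refine h1.congr' ?_
  filter_upwards [eventually_gt_atTop 0] with z hz
  simp only [Function.comp, one_div, inv_inv, inv_pow]
  field_simp

/-- Beyond any threshold, the balance `m ℓ'(-1) = 2 P ℓ'(P)` holds for some integer `m`. -/
lemma exists_nat_balance (hA : AssumptionA ℓ) (P₀ : ℝ) :
    ∃ (m : ℕ) (P : ℝ), P₀ ≤ P ∧ m * deriv ℓ (-1) = 2 * P * deriv ℓ P := by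
  have hc := hA.deriv_pos (-1)
  set F : ℝ → ℝ := fun P => 2 * P * deriv ℓ P / deriv ℓ (-1)
  have hFc : Continuous F := by
    have := hA.continuous_deriv
    fun_prop
  have hFt : Tendsto F atTop atTop :=
    ((tendsto_id.const_mul_atTop (by norm_num : (0 : ℝ) < 2)).atTop_mul_pos one_pos
      hA.deriv_tendsto_one_atTop).atTop_div_const hc
  obtain ⟨m, hm⟩ := exists_nat_ge (F P₀)
  obtain ⟨Q, hQ, hmQ⟩ := ((eventually_ge_atTop P₀).and (hFt.eventually_ge_atTop (m : ℝ))).exists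
  obtain ⟨P, hP, hPm⟩ := intermediate_value_Icc hQ hFc.continuousOn ⟨hm, hmQ⟩
  refine ⟨m, P, hP.1, ?_⟩
  rw [← hPm]
  simp only [F]
  field_simp

end AssumptionA

/-- If `G u` is strictly increasing with values of both signs for every `u`, its zero depends
continuously on `u`. -/
lemma exists_continuous_root {G : ℝ → ℝ → ℝ} (hG : Continuous (Function.uncurry G))
    (hmono : ∀ u, StrictMono (G u)) (hneg : ∀ u, ∃ p, G u p < 0) (hpos : ∀ u, ∃ p, 0 < G u p) :
    ∃ r : ℝ → ℝ, Continuous r ∧ ∀ u, G u (r u) = 0 := by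
  have hGu : ∀ u, Continuous (G u) := fun u => hG.comp (by fun_prop : Continuous fun p => (u, p))
  have hGp : ∀ p, Continuous (fun u => G u p) := fun p =>
    hG.comp (by fun_prop : Continuous fun u => (u, p))
  have hex : ∀ u, ∃ p, G u p = 0 := fun u => by
    obtain ⟨a, ha⟩ := hneg u
    obtain ⟨b, hb⟩ := hpos u
    exact mem_range_of_exists_le_of_exists_ge (hGu u) ⟨a, ha.le⟩ ⟨b, hb.le⟩
  choose r hr using hex
  refine ⟨r, continuous_iff_continuousAt.2 fun u => ?_, hr⟩
  refine tendsto_order.2 ⟨fun a ha => ?_, fun b hb => ?_⟩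
  · have h : G u a < 0 := hr u ▸ hmono u ha
    filter_upwards [(hGp a).continuousAt.eventually_lt_const h] with v hv
    exact (hmono v).lt_iff_lt.1 (by rwa [hr v])
  · have h : 0 < G u b := hr u ▸ hmono u hb
    filter_upwards [(hGp b).continuousAt.eventually_const_lt h] with v hv
    exact (hmono v).lt_iff_lt.1 (by rwa [hr v])

/-- Scalar data of a symmetric two-cycle: `P` is the minimizer's first coordinate, and
`(p, ± u)` are the points of the cycle in rescaled coordinates. -/
lemma AssumptionA.exists_cycle_data {ℓ : ℝ → ℝ} (hA : AssumptionA ℓ) {γ : ℝ}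
    (hγ : γ ∈ Set.Ioc (0 : ℝ) 1) :
    ∃ (m : ℕ) (P p u : ℝ), 0 < P ∧ 0 < u ∧ 0 < m ∧
      m * deriv ℓ (-1) = 2 * P * deriv ℓ P ∧
      m / P * deriv ℓ (-p / P) = deriv ℓ (p + u) + deriv ℓ (p - u) ∧
      γ * (deriv ℓ (p + u) - deriv ℓ (p - u)) = 4 * u * deriv (deriv ℓ) P := by
  obtain ⟨hγ0, hγ1⟩ := hγ
  have hf := hA.deriv_strictMono
  have hfc := hA.continuous_deriv
  have hc := hA.deriv_pos (-1)
  obtain ⟨K, hK1, hK⟩ : ∃ K, 1 ≤ K ∧ deriv ℓ (-K) ≤ deriv ℓ (-1) / 2 := by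
    have h := (hA.deriv_tendsto_zero_atBot.comp tendsto_neg_atTop_atBot).eventually_le_const
      (half_pos hc)
    exact ((eventually_ge_atTop (1 : ℝ)).and h).exists
  have hlow := (hA.deriv_tendsto_zero_atBot.comp tendsto_neg_atTop_atBot).eventually_le_const
      (by norm_num : (0 : ℝ) < 1 / 4)
  have hhigh := hA.deriv_tendsto_one_atTop.eventually_const_le (by norm_num : (3 / 4 : ℝ) < 1)
  have hcurv := hA.tendsto_mul_secondDeriv.eventually_le_const
    (by positivity : (0 : ℝ) < γ / (16 * K))
  obtain ⟨P₀, hP₀⟩ := eventually_atTop.1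
    ((eventually_ge_atTop (1 : ℝ)).and (hlow.and (hhigh.and hcurv)))
  obtain ⟨m, P, hP, hbal⟩ := hA.exists_nat_balance P₀
  obtain ⟨hP1, hPlow, hPhigh, hPcurv⟩ := hP₀ P hP
  simp only [Function.comp] at hPlow
  have hPpos : 0 < P := by linarith
  have hm : 0 < m := by
    rcases Nat.eq_zero_or_pos m with h | h
    · have := mul_pos (mul_pos two_pos hPpos) (hA.deriv_pos P)
      rw [← hbal, h] at this
      simp at this
    · exact h
  have hm' : (0 : ℝ) < m := by exact_mod_cast hm
  have hbal' : m / P * deriv ℓ (-1) = 2 * deriv ℓ P := by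
    field_simp
    linarith
  have hmP : 0 < m / P := by positivity
  set G : ℝ → ℝ → ℝ := fun u p =>
    deriv ℓ (p + u) + deriv ℓ (p - u) - m / P * deriv ℓ (-p / P) with hGdef
  have hG : Continuous (Function.uncurry G) := by
    simp only [hGdef, Function.uncurry_def]
    fun_prop
  have hGmono : ∀ u, StrictMono (G u) := fun u a b hab => by
    have h1 := hf (by linarith : a + u < b + u)
    have h2 := hf (by linarith : a - u < b - u)
    have h3 := mul_lt_mul_of_pos_left
      (hf (div_lt_div_of_pos_right (neg_lt_neg hab) hPpos)) hmP
    simp only [hGdef]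
    linarith
  have hGneg : ∀ u, ∃ p, G u p < 0 := fun u => by
    have h1 : Tendsto (G u) atBot (𝓝 (0 + 0 - m / P * 1)) :=
      ((hA.deriv_tendsto_zero_atBot.comp (tendsto_atBot_add_const_right _ u tendsto_id)).add
        (hA.deriv_tendsto_zero_atBot.comp (tendsto_atBot_add_const_right _ (-u) tendsto_id))).sub
        ((hA.deriv_tendsto_one_atTop.comp
          (tendsto_neg_atBot_atTop.atTop_div_const hPpos)).const_mul _)
    exact (h1.eventually_lt_const (by linarith)).exists
  have hGpos : ∀ u, ∃ p, 0 < G u p := fun u => by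
    have h1 : Tendsto (G u) atTop (𝓝 (1 + 1 - m / P * 0)) :=
      ((hA.deriv_tendsto_one_atTop.comp (tendsto_atTop_add_const_right _ u tendsto_id)).add
        (hA.deriv_tendsto_one_atTop.comp (tendsto_atTop_add_const_right _ (-u) tendsto_id))).sub
        ((hA.deriv_tendsto_zero_atBot.comp
          (tendsto_neg_atTop_atBot.atBot_div_const hPpos)).const_mul _)
    exact (h1.eventually_const_lt (by norm_num)).exists
  obtain ⟨r, hrc, hr⟩ := exists_continuous_root hG hGmono hGneg hGpos
  have hr0 : r 0 = P := (hGmono 0).injective <| by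
    rw [hr]
    simp only [hGdef, neg_div, div_self hPpos.ne', hbal', add_zero, sub_zero]
    ring
  have hKP : P ≤ K * P := le_mul_of_one_le_left hPpos.le hK1
  set U := 2 * (K * P) with hU
  have hrU0 : 0 ≤ r U := (hGmono U).le_iff_le.1 <| by
    rw [hr]
    have h1 := hA.deriv_le_one (0 + U)
    have h2 := hf.monotone (by linarith : 0 - U ≤ -P)
    have h3 := mul_le_mul_of_nonneg_left
      (hf.monotone (by simp : (-1 : ℝ) ≤ -0 / P)) hmP.le
    simp only [hGdef]
    linarith
  have hrUK : r U ≤ K * P := (hGmono U).le_iff_le.1 <| by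
    rw [hr]
    have h1 := hf.monotone (by linarith : P ≤ K * P + U)
    have h2 := hA.deriv_pos (K * P - U)
    have h3 := mul_le_mul_of_nonneg_left hK hmP.le
    have h4 : -(K * P) / P = -K := by field_simp
    simp only [hGdef, h4]
    linarith
  set h : ℝ → ℝ := fun u =>
    γ * (deriv ℓ (r u + u) - deriv ℓ (r u - u)) - 4 * u * deriv (deriv ℓ) P with hh
  have hhc : Continuous h := by fun_prop
  have hUh : 0 ≤ h U := by
    have h1 := hf.monotone (by linarith : P ≤ r U + U)
    have h2 := hf.monotone (by linarith : r U - U ≤ -P)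
    have h3 : γ * (1 / 2) ≤ γ * (deriv ℓ (r U + U) - deriv ℓ (r U - U)) :=
      mul_le_mul_of_nonneg_left (by linarith) hγ0.le
    rw [le_div_iff₀ (by positivity)] at hPcurv
    simp only [hh, hU] at h3 ⊢
    linarith
  obtain ⟨v, hv0, hvU, hv⟩ : ∃ v, 0 < v ∧ v ≤ U ∧ h v < 0 := by
    have hd := hA.secondDeriv_pos P
    obtain ⟨δ, hδ, hball⟩ := Metric.eventually_nhds_iff.1
      (hA.continuous_secondDeriv.continuousAt.eventually_lt_const
        (by linarith : deriv (deriv ℓ) P < 2 * deriv (deriv ℓ) P))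
    have hrδ := (hrc.tendsto' 0 P hr0).eventually (Metric.ball_mem_nhds P (half_pos hδ))
    obtain ⟨ρ, hρ, hrho⟩ := Metric.eventually_nhds_iff.1 hrδ
    obtain ⟨v, hv0, hv⟩ := exists_between
      (lt_min hρ (lt_min (half_pos hδ) (by linarith : 0 < U)))
    simp only [lt_min_iff] at hv
    obtain ⟨hvρ, hvδ, hvU⟩ := hv
    refine ⟨v, hv0, hvU.le, ?_⟩
    have hrv : |r v - P| < δ / 2 := by
      have := hrho (y := v) (by simpa [abs_of_pos hv0] using hvρ)
      simpa [Real.dist_eq] using this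
    obtain ⟨ξ, hξ, hslope⟩ := exists_deriv_eq_slope (deriv ℓ) (by linarith : r v - v < r v + v)
      hfc.continuousOn hA.differentiable_deriv.differentiableOn
    have hξd := hball (y := ξ) (by
      rw [Real.dist_eq, abs_lt]
      rw [abs_lt] at hrv
      constructor <;> linarith [hξ.1, hξ.2])
    rw [eq_div_iff (by linarith)] at hslope
    have hξp := hA.secondDeriv_pos ξ
    have h1 : γ * (deriv ℓ (r v + v) - deriv ℓ (r v - v)) ≤
        deriv ℓ (r v + v) - deriv ℓ (r v - v) :=
      mul_le_of_le_one_left (sub_nonneg.2 (hf.monotone (by linarith))) hγ1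
    have h2 := mul_lt_mul_of_pos_right hξd (by linarith : 0 < 2 * v)
    simp only [hh]
    linarith
  obtain ⟨u, hu, hu0⟩ := intermediate_value_Icc hvU hhc.continuousOn ⟨hv.le, hUh⟩
  refine ⟨m, P, r u, u, hPpos, hv0.trans_le hu.1, hm, hbal, ?_, ?_⟩
  · have := hr u
    simp only [hGdef] at this
    linarith
  · simp only [hh] at hu0
    linarith

/-- For any loss `ℓ` satisfying Assumption A and any `γ ∈ (0,1]`,
there exists a two-dimensional non-separable classification problem on which some GD
trajectory with constant step size `η = γ/λ_max(∇²L(w*))` converges to a cycle of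
period `k > 1`. -/
theorem gd_two_dim_cycle
    (ℓ : ℝ → ℝ) (hA : AssumptionA ℓ)
    (γ : ℝ) (hγ : γ ∈ Set.Ioc (0 : ℝ) 1) :
    ∃ (n : ℕ), 0 < n ∧ ∃ (x : Fin n → Fin 2 → ℝ) (y : Fin n → ℝ),
      (∀ i, y i = 1 ∨ y i = -1) ∧
      (∀ w : Fin 2 → ℝ, ∃ i, y i * (∑ j, w j * x i j) ≤ 0) ∧
      ∃ (L : (Fin 2 → ℝ) → ℝ) (g : (Fin 2 → ℝ) → Fin 2 → ℝ)
        (H : Matrix (Fin 2) (Fin 2) ℝ),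
        -- the objective
        (∀ w, L w = (1 / (n : ℝ)) * ∑ i, ℓ (-(y i) * ∑ j, w j * x i j)) ∧
        -- its gradient
        (∀ w j, g w j =
          (1 / (n : ℝ)) * ∑ i, deriv ℓ (-(y i) * ∑ j', w j' * x i j') * (-(y i) * x i j)) ∧
        ∃ (wstar : Fin 2 → ℝ),
          (∀ w, L wstar ≤ L w) ∧
          -- the Hessian at the minimizer
          (∀ a b, H a b =
            (1 / (n : ℝ)) *
              ∑ i, deriv (deriv ℓ) (-(y i) * ∑ j', wstar j' * x i j') * x i a * x i b) ∧
          ∃ (lam : ℝ),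
            -- `lam` is the largest eigenvalue of the Hessian at the minimizer
            (∃ v : Fin 2 → ℝ, v ≠ 0 ∧ H.mulVec v = lam • v) ∧
            (∀ (μ : ℝ) (v : Fin 2 → ℝ), v ≠ 0 → H.mulVec v = μ • v → μ ≤ lam) ∧
            ∃ (η : ℝ), η = γ / lam ∧
            ∃ (k : ℕ), 1 < k ∧
            ∃ (c : ℕ → Fin 2 → ℝ) (w₀ : Fin 2 → ℝ) (w : ℕ → Fin 2 → ℝ),
              (∀ j₁ j₂, j₁ < k → j₂ < k → c j₁ = c j₂ → j₁ = j₂) ∧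
              (∀ j, c j - η • g (c j) = c (j + 1)) ∧
              c k = c 0 ∧
              w 0 = w₀ ∧
              (∀ t, w (t + 1) = w t - η • g (w t)) ∧
              (∀ j, Tendsto (fun t => w (k * t + j)) atTop (𝓝 (c j))) := by
  obtain ⟨m, P, p, u, hP, hu, hm, hbal, hp, hcyc⟩ := hA.exists_cycle_data hγ
  have hd := hA.secondDeriv_pos P
  have hd1 := hA.secondDeriv_pos (-1)
  set b : ℝ := 1 + m * deriv (deriv ℓ) (-1) / (P ^ 2 * (2 * deriv (deriv ℓ) P)) with hb
  have hb0 : 0 < b := by positivity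
  set β : ℝ := √b
  have hβ : 0 < β := Real.sqrt_pos.2 hb0
  have hββ : β ^ 2 = b := Real.sq_sqrt hb0.le
  have hbd : 2 * deriv (deriv ℓ) P * β ^ 2 =
      2 * deriv (deriv ℓ) P + m * deriv (deriv ℓ) (-1) / P ^ 2 := by
    rw [hββ, hb]
    field_simp
  set x : Fin (m + 2) → Fin 2 → ℝ :=
    Fin.cons ![1, β] (Fin.cons ![1, -β] fun _ => ![-1 / P, 0]) with hx
  set n : ℝ := ((m + 2 : ℕ) : ℝ) with hn
  have hn0 : 0 < n := by positivity
  set lam : ℝ := 1 / n * (2 * deriv (deriv ℓ) P * β ^ 2) with hlam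
  have hlam0 : 0 < lam := by positivity
  set g : (Fin 2 → ℝ) → Fin 2 → ℝ := fun w j =>
    1 / n * ∑ i, deriv ℓ (-(-1) * ∑ j', w j' * x i j') * (-(-1) * x i j) with hg
  have hg0 : ∀ a c, g ![a, c] 0 = 1 / n * (deriv ℓ (a + c * β) + deriv ℓ (a - c * β) -
      m / P * deriv ℓ (-a / P)) := fun a c => by
    simp only [hg]
    congr 1
    simp [hx, Fin.sum_univ_succ, sub_eq_add_neg]
    ring_nf
  have hg1 : ∀ a c, g ![a, c] 1 = 1 / n * (β * (deriv ℓ (a + c * β) - deriv ℓ (a - c * β))) :=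
    fun a c => by
    simp only [hg]
    congr 1
    simp [hx, Fin.sum_univ_succ, sub_eq_add_neg]
    ring_nf
  set H : Matrix (Fin 2) (Fin 2) ℝ := fun a c => 1 / n *
    ∑ i, deriv (deriv ℓ) (-(-1) * ∑ j', ![P, 0] j' * x i j') * x i a * x i c with hH
  have hPP : P * (-1 / P) = -1 := by field_simp
  have hH00 : H 0 0 = lam := by
    rw [hlam, hbd]
    simp only [hH]
    congr 1
    simp [hx, Fin.sum_univ_succ, hPP]
    ring
  have hH01 : H 0 1 = 0 := by simp [hH, hx, Fin.sum_univ_succ]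
  have hH10 : H 1 0 = 0 := by simp [hH, hx, Fin.sum_univ_succ]
  have hH11 : H 1 1 = lam := by
    rw [hlam]
    simp only [hH]
    congr 1
    simp [hx, Fin.sum_univ_succ]
    ring
  have hHv : ∀ v, H.mulVec v = lam • v := fun v => by
    ext j
    fin_cases j <;> simp [Matrix.mulVec, dotProduct, Fin.sum_univ_two, hH00, hH01, hH10, hH11]
  set η : ℝ := γ / lam with hη
  set q : ℝ := u / β with hq
  have hq0 : 0 < q := by positivity
  have hqβ : q * β = u := by simp only [hq]; field_simp
  have hgp : g ![p, q] 0 = 0 := by rw [hg0, hqβ, ← hp]; ring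
  have hgn : g ![p, -q] 0 = 0 := by
    rw [hg0, neg_mul, hqβ, sub_neg_eq_add, ← sub_eq_add_neg, add_comm (deriv ℓ _), ← hp]; ring
  have hηβ : η * (1 / n * (β * (deriv ℓ (p + u) - deriv ℓ (p - u)))) = 2 * q := by
    have h1 : η * (1 / n * (β * (deriv ℓ (p + u) - deriv ℓ (p - u)))) =
        γ * (deriv ℓ (p + u) - deriv ℓ (p - u)) / (2 * deriv (deriv ℓ) P * β) := by
      simp only [hη, hlam]
      field_simp
    rw [h1, hcyc, hq]
    field_simp
    ring
  have hstep : ![p, q] - η • g ![p, q] = ![p, -q] := by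
    ext j
    fin_cases j
    · simp [hgp]
    · simp [hg1, hqβ] at hηβ ⊢
      linarith
  have hstep' : ![p, -q] - η • g ![p, -q] = ![p, q] := by
    ext j
    fin_cases j
    · simp [hgn]
    · simp [hg1, hqβ, ← sub_eq_add_neg] at hηβ ⊢
      linarith
  set c : ℕ → Fin 2 → ℝ := fun j => if Even j then ![p, q] else ![p, -q] with hc
  have hcs : ∀ j, c j - η • g (c j) = c (j + 1) := fun j => by
    by_cases h : Even j
    · simpa [hc, h, Nat.even_add_one] using hstep
    · simpa [hc, h, Nat.even_add_one] using hstep'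
  refine ⟨m + 2, by omega, x, fun _ => -1, fun _ => Or.inr rfl, fun w => ?_, fun w =>
    1 / n * ∑ i, ℓ (-(-1) * ∑ j, w j * x i j), g, H, fun _ => rfl, fun _ _ => rfl, ![P, 0],
    fun w => ?_, fun _ _ => rfl, lam, ⟨![1, 0], fun h => ?_, hHv _⟩, fun μ v hv hμ => ?_,
    η, rfl, 2, one_lt_two, c, c 0, c, fun i j hi hj hij => ?_, hcs, ?_, rfl,
    fun t => (hcs t).symm, fun j => ?_⟩
  · by_contra! h
    have h0 := h 0
    have h1 := h 1
    have h2 := h (Fin.succ (Fin.succ ⟨0, hm⟩))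
    rw [← Fin.succ_zero_eq_one] at h1
    simp only [hx, Fin.cons_zero, Fin.cons_succ, Fin.sum_univ_two, Matrix.cons_val_zero,
      Matrix.cons_val_one] at h0 h1 h2
    have h3 : 0 < w 0 / P := by
      have : w 0 / P = -1 * (w 0 * (-1 / P) + w 1 * 0) := by ring
      rwa [this]
    rw [div_pos_iff_of_pos_right hP] at h3
    linarith
  · refine mul_le_mul_of_nonneg_left ?_ (by positivity)
    have h0 := hA.tangent_le P (w 0 + w 1 * β)
    have h1 := hA.tangent_le P (w 0 + -(w 1 * β))
    have h2 := mul_le_mul_of_nonneg_left (hA.tangent_le (-1) (w 0 * (-1 / P))) m.cast_nonneg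
    have h3 : m * (deriv ℓ (-1) * (w 0 * (-1 / P) - -1)) = -(2 * deriv ℓ P * (w 0 - P)) := by
      rw [← mul_assoc, hbal]
      field_simp
      ring
    simp [hx, Fin.sum_univ_succ, hPP] at h2 h3 ⊢
    linarith
  · simpa using congrFun h 0
  · rw [hHv] at hμ
    exact (smul_left_injective ℝ hv hμ).ge
  · have h : ∀ j, c j 1 = if Even j then q else -q := fun j => by
      by_cases h : Even j <;> simp [hc, h]
    have := congrFun hij 1
    rw [h, h] at this
    interval_cases i <;> interval_cases j <;> simp at this ⊢ <;> linarith
  · simp [hc]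
  · refine tendsto_const_nhds.congr fun t => ?_
    simp [hc, Nat.even_add]
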